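/- arXiv:1611.05296 — 2 statements merged into one kernel-verified Lean document; each statement's English description precedes it below -/
import Mathlib

section
/- Let B be an open ball in R^d with center x_0, let u be harmonic in B and continuous on the closure of B. Then for every p > 0 there is a constant C_p (depending only on p and d) such that |u(x_0)|^p ≤ C_p · (1/|B|) ∫_B |u(x)|^p dx. -/
open MeasureTheory

open Metric Set Filter Topology

lemma hasDerivAt_max_zero_pow_three (t : ℝ) :
    HasDerivAt (fun t : ℝ => (max 0 t) ^ 3) (3 * (max 0 t) ^ 2) t := by
  rcases lt_trichotomy t 0 with h | rfl | h
  · have : (fun t : ℝ => (max 0 t) ^ 3) =ᶠ[𝓝 t] fun _ => 0 := by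
      filter_upwards [Iio_mem_nhds h] with a ha
      simp [max_eq_left (le_of_lt (mem_Iio.1 ha))]
    simpa [max_eq_left h.le] using (hasDerivAt_const t (0 : ℝ)).congr_of_eventuallyEq this
  · rw [hasDerivAt_iff_isLittleO_nhds_zero]
    have h1 : (fun h : ℝ => h ^ 3) =o[𝓝 0] fun h : ℝ => h := by
      simpa using Asymptotics.isLittleO_pow_pow (𝕜 := ℝ) (m := 1) (n := 3) (by norm_num)
    refine (Asymptotics.IsBigO.of_bound 1 (Eventually.of_forall fun h => ?_)).trans_isLittleO h1
    have : |max 0 h| ≤ |h| := by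
      rcases le_total 0 h with h' | h' <;> simp [h']
    simpa using pow_le_pow_left₀ (abs_nonneg _) this 3
  · have : (fun t : ℝ => (max 0 t) ^ 3) =ᶠ[𝓝 t] fun t => t ^ 3 := by
      filter_upwards [Ioi_mem_nhds h] with a ha
      simp [max_eq_right (le_of_lt (mem_Ioi.1 ha))]
    simpa [max_eq_right h.le] using (hasDerivAt_pow 3 t).congr_of_eventuallyEq this

section

variable {E : Type*} [NormedAddCommGroup E]

/-- A `C¹` radial weight supported in the closed unit ball. -/
noncomputable def radialWeight (y : E) : ℝ := (max 0 (1 - ‖y‖ ^ 2)) ^ 2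

/-- A radial function supported in the closed unit ball whose gradient at `y` is
`radialWeight y • y`. -/
noncomputable def radialPotential (y : E) : ℝ := -(1 / 6) * (max 0 (1 - ‖y‖ ^ 2)) ^ 3

lemma continuous_radialWeight : Continuous (radialWeight : E → ℝ) := by
  unfold radialWeight; fun_prop

lemma radialWeight_nonneg (y : E) : 0 ≤ radialWeight y := sq_nonneg _

lemma radialWeight_le_one (y : E) : radialWeight y ≤ 1 := by
  refine pow_le_one₀ (le_max_left _ _) (max_le zero_le_one ?_)
  nlinarith [sq_nonneg ‖y‖]

lemma max_zero_one_sub_normSq_eq_zero {y : E} (hy : y ∉ ball (0 : E) 1) :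
    max 0 (1 - ‖y‖ ^ 2) = 0 := by
  rw [mem_ball_zero_iff, not_lt] at hy
  exact max_eq_left (by nlinarith)

lemma radialWeight_eq_zero {y : E} (hy : y ∉ ball (0 : E) 1) : radialWeight y = 0 := by
  simp [radialWeight, max_zero_one_sub_normSq_eq_zero hy]

lemma radialPotential_eq_zero {y : E} (hy : y ∉ ball (0 : E) 1) : radialPotential y = 0 := by
  simp [radialPotential, max_zero_one_sub_normSq_eq_zero hy]

lemma continuous_radialPotential : Continuous (radialPotential : E → ℝ) := by
  unfold radialPotential; fun_prop

variable [InnerProductSpace ℝ E]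

lemma hasFDerivAt_radialPotential (y : E) :
    HasFDerivAt radialPotential (radialWeight y • innerSL ℝ y) y := by
  have h1 : HasFDerivAt (fun y : E => 1 - ‖y‖ ^ 2) (-(2 • innerSL ℝ y)) y :=
    (hasStrictFDerivAt_norm_sq y).hasFDerivAt.const_sub 1
  have h2 := ((hasDerivAt_max_zero_pow_three (1 - ‖y‖ ^ 2)).comp_hasFDerivAt y h1).const_mul
    (-(1 / 6 : ℝ))
  refine HasFDerivAt.congr_fderiv h2 ?_
  ext z
  simp [radialWeight]
  ring

variable [FiniteDimensional ℝ E]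

lemma hasCompactSupport_radialWeight : HasCompactSupport (radialWeight : E → ℝ) :=
  .of_support_subset_isCompact (isCompact_closedBall 0 1) fun y hy => by
    by_contra h
    exact hy (radialWeight_eq_zero fun h' => h (ball_subset_closedBall h'))

lemma hasCompactSupport_radialPotential : HasCompactSupport (radialPotential : E → ℝ) :=
  .of_support_subset_isCompact (isCompact_closedBall 0 1) fun y hy => by
    by_contra h
    exact hy (radialPotential_eq_zero fun h' => h (ball_subset_closedBall h'))

variable [MeasurableSpace E] [BorelSpace E]

lemma integral_radialWeight_pos : 0 < ∫ y : E, radialWeight y := by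
  refine continuous_radialWeight.integral_pos_of_hasCompactSupport_nonneg_nonzero
    hasCompactSupport_radialWeight radialWeight_nonneg (x := 0) ?_
  simp [radialWeight]

/-- Integration by parts against the radial potential. -/
lemma integral_radialWeight_mul_inner {w : E → ℝ} (hw : ContDiff ℝ 1 w) (e : E) :
    ∫ y, radialWeight y * inner ℝ y e * w y = -∫ y, radialPotential y * fderiv ℝ w y e := by
  have hd : ∀ y : E, fderiv ℝ radialPotential y e = radialWeight y * inner ℝ y e := fun y => by
    rw [(hasFDerivAt_radialPotential y).fderiv]; simp
  have hw' : Continuous fun y => fderiv ℝ w y e :=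
    (hw.continuous_fderiv one_ne_zero).clm_apply continuous_const
  have := integral_mul_fderiv_eq_neg_fderiv_mul_of_integrable (μ := (volume : Measure E))
    (f := radialPotential) (g := w) (v := e) ?_ ?_ ?_
    (fun y _ => (hasFDerivAt_radialPotential y).differentiableAt)
    (fun y _ => (hw.differentiable one_ne_zero).differentiableAt)
  · simp only [hd] at this
    rw [this, neg_neg]
  · simp only [hd]
    have h : Continuous fun y : E => radialWeight y * (inner ℝ y e * w y) :=
      continuous_radialWeight.mul ((by fun_prop : Continuous fun y : E => inner ℝ y e).mul
        hw.continuous)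
    simpa only [mul_assoc] using
      h.integrable_of_hasCompactSupport hasCompactSupport_radialWeight.mul_right
  · exact (continuous_radialPotential.mul hw').integrable_of_hasCompactSupport
      hasCompactSupport_radialPotential.mul_right
  · exact (continuous_radialPotential.mul hw.continuous).integrable_of_hasCompactSupport
      hasCompactSupport_radialPotential.mul_right

lemma hasDerivAt_integral_radialWeight {v : E → ℝ} (hv : ContDiff ℝ 1 v)
    (hc : HasCompactSupport v) (x : E) (t : ℝ) :
    HasDerivAt (fun t : ℝ => ∫ y, radialWeight y * v (x + t • y))
      (∫ y, radialWeight y * fderiv ℝ v (x + t • y) y) t := by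
  have hv' := hv.continuous_fderiv one_ne_zero
  obtain ⟨M, hM⟩ := (hc.fderiv ℝ).exists_bound_of_continuous hv'
  have hcont : ∀ t : ℝ, Continuous fun y => radialWeight y * v (x + t • y) := fun t =>
    continuous_radialWeight.mul (hv.continuous.comp (by fun_prop))
  have hcont' : ∀ t : ℝ, Continuous fun y => radialWeight y * fderiv ℝ v (x + t • y) y := fun t =>
    continuous_radialWeight.mul ((hv'.comp
      (by fun_prop : Continuous fun y : E => x + t • y)).clm_apply
      continuous_id)
  refine (hasDerivAt_integral_of_dominated_loc_of_deriv_le (s := univ)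
    (F' := fun t y => radialWeight y * fderiv ℝ v (x + t • y) y)
    (bound := fun y => radialWeight y * (M * ‖y‖)) univ_mem
    (.of_forall fun t => (hcont t).aestronglyMeasurable)
    ((hcont t).integrable_of_hasCompactSupport hasCompactSupport_radialWeight.mul_right)
    (hcont' t).aestronglyMeasurable (.of_forall fun y s _ => ?_) ?_
    (.of_forall fun y s _ => ?_)).2
  · rw [norm_mul, Real.norm_of_nonneg (radialWeight_nonneg y)]
    exact mul_le_mul_of_nonneg_left ((fderiv ℝ v (x + s • y)).le_of_opNorm_le (hM _) y)
      (radialWeight_nonneg y)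
  · exact (continuous_radialWeight.mul (by fun_prop)).integrable_of_hasCompactSupport
      hasCompactSupport_radialWeight.mul_right
  · have h1 : HasDerivAt (fun s : ℝ => x + s • y) y s := by
      simpa using ((hasDerivAt_id s).smul_const y).const_add x
    exact ((hv.differentiable one_ne_zero (x + s • y)).hasFDerivAt.comp_hasDerivAt s h1).const_mul _

/-- The radially weighted means of a function harmonic on a ball equal its value at the center. -/
lemma integral_radialWeight_mul_eq {ι : Type*} [Fintype ι] (b : OrthonormalBasis ι ℝ E)
    {v : E → ℝ} (hv : ContDiff ℝ 2 v) (hc : HasCompactSupport v) (x : E) {s : ℝ} (hs : 0 ≤ s)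
    (hΔ : ∀ y ∈ ball x s, ∑ i, fderiv ℝ (fun z => fderiv ℝ v z (b i)) y (b i) = 0) :
    ∫ y, radialWeight y * v (x + s • y) = v x * ∫ y : E, radialWeight y := by
  have hv1 : ContDiff ℝ 1 v := hv.of_le (by norm_num)
  have hD : ∀ i, ContDiff ℝ 1 fun z => fderiv ℝ v z (b i) := fun i =>
    (hv.fderiv_right (m := 1) (by norm_num)).clm_apply contDiff_const
  have hder := hasDerivAt_integral_radialWeight hv1 hc x
  have hzero : ∀ t ∈ Ico 0 s, ∫ y, radialWeight y * fderiv ℝ v (x + t • y) y = 0 := by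
    intro t ht
    have haff : ∀ y, HasFDerivAt (fun y : E => x + t • y) (t • ContinuousLinearMap.id ℝ E) y :=
      fun y => ((hasFDerivAt_id y).const_smul t).const_add x
    have hw : ∀ i, ContDiff ℝ 1 fun y => fderiv ℝ v (x + t • y) (b i) := fun i =>
      (hD i).comp (by fun_prop)
    have hwd : ∀ i y, fderiv ℝ (fun y => fderiv ℝ v (x + t • y) (b i)) y (b i)
        = t * fderiv ℝ (fun z => fderiv ℝ v z (b i)) (x + t • y) (b i) := by
      intro i y
      have := (((hD i).differentiable one_ne_zero (x + t • y)).hasFDerivAt.comp y (haff y)).fderiv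
      simp only [Function.comp_def] at this
      rw [this]; simp
    have hexp : ∀ y, radialWeight y * fderiv ℝ v (x + t • y) y
        = ∑ i, radialWeight y * inner ℝ y (b i) * fderiv ℝ v (x + t • y) (b i) := by
      intro y
      have := congrArg (fderiv ℝ v (x + t • y)) (b.sum_repr' y)
      rw [← this]
      simp only [map_sum, map_smul, smul_eq_mul, Finset.mul_sum, mul_assoc, real_inner_comm]
    simp only [hexp]
    rw [integral_finsetSum]
    · simp only [integral_radialWeight_mul_inner (hw _), hwd]
      rw [Finset.sum_neg_distrib, ← integral_finsetSum]
      · rw [neg_eq_zero]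
        refine integral_eq_zero_of_ae (.of_forall fun y => ?_)
        simp only [Pi.zero_apply, ← Finset.mul_sum]
        by_cases hy : y ∈ ball (0 : E) 1
        · rw [hΔ, mul_zero, mul_zero]
          rw [mem_ball_zero_iff] at hy
          rw [mem_ball_iff_norm, add_sub_cancel_left, norm_smul, Real.norm_of_nonneg ht.1]
          nlinarith [ht.1, ht.2, norm_nonneg y]
        · rw [radialPotential_eq_zero hy, zero_mul]
      · intro i _
        simp only [← hwd]
        exact (continuous_radialPotential.mul (((hw i).continuous_fderiv one_ne_zero).clm_apply
          continuous_const)).integrable_of_hasCompactSupport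
          hasCompactSupport_radialPotential.mul_right
    · intro i _
      have h : Continuous fun y : E =>
          radialWeight y * (inner ℝ y (b i) * fderiv ℝ v (x + t • y) (b i)) :=
        continuous_radialWeight.mul ((by fun_prop : Continuous fun y : E => inner ℝ y (b i)).mul
          (hw i).continuous)
      simpa only [mul_assoc] using
        h.integrable_of_hasCompactSupport hasCompactSupport_radialWeight.mul_right
  have hconst := constant_of_has_deriv_right_zero
    (f := fun t : ℝ => ∫ y, radialWeight y * v (x + t • y)) (a := 0) (b := s)
    (fun t _ => (hder t).continuousAt.continuousWithinAt)
    (fun t ht => by simpa only [hzero t ht] using (hder t).hasDerivWithinAt) s ⟨hs, le_rfl⟩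
  rw [hconst]
  simp [mul_comm _ (v x), integral_const_mul]

/-- The mean value inequality, up to the constant `(∫ radialWeight)⁻¹`. -/
lemma abs_mul_integral_radialWeight_le {ι : Type*} [Fintype ι] (b : OrthonormalBasis ι ℝ E)
    {v : E → ℝ} (hv : ContDiff ℝ 2 v) (hc : HasCompactSupport v) (x : E) {s : ℝ} (hs : 0 < s)
    (hΔ : ∀ y ∈ ball x s, ∑ i, fderiv ℝ (fun z => fderiv ℝ v z (b i)) y (b i) = 0) :
    |v x| * ∫ y : E, radialWeight y ≤ (s ^ Module.finrank ℝ E)⁻¹ * ∫ y in ball x s, |v y| := by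
  have hcv : Continuous fun y : E => v (x + s • y) := hv.continuous.comp (by fun_prop)
  calc |v x| * ∫ y : E, radialWeight y = |∫ y, radialWeight y * v (x + s • y)| := by
        rw [integral_radialWeight_mul_eq b hv hc x hs.le hΔ, abs_mul,
          abs_of_pos integral_radialWeight_pos]
    _ = |∫ y in ball (0 : E) 1, radialWeight y * v (x + s • y)| := by
        rw [setIntegral_eq_integral_of_forall_compl_eq_zero fun y hy => ?_]
        rw [radialWeight_eq_zero hy, zero_mul]
    _ ≤ ∫ y in ball (0 : E) 1, |v (x + s • y)| := by
        refine norm_integral_le_of_norm_le (f := fun y => radialWeight y * v (x + s • y)) ?_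
          (.of_forall fun y => ?_)
        · exact (hcv.abs.continuousOn.integrableOn_compact
            (isCompact_closedBall 0 1)).mono_set ball_subset_closedBall
        · rw [norm_mul, Real.norm_of_nonneg (radialWeight_nonneg y)]
          exact mul_le_of_le_one_left (abs_nonneg _) (radialWeight_le_one y)
    _ = (s ^ Module.finrank ℝ E)⁻¹ * ∫ y in ball x s, |v y| := by
        rw [Measure.setIntegral_comp_smul_of_pos volume (fun y => |v (x + y)|) _ hs, smul_eq_mul,
          smul_unitBall_of_pos hs]
        congr 1
        have := (measurePreserving_add_left (volume : Measure E) x).setIntegral_preimage_emb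
          (measurableEmbedding_addLeft x) (fun y => |v y|) (ball x s)
        rwa [preimage_add_ball, sub_self] at this

end

lemma iteratedDeriv_two_line {E : Type*} [NormedAddCommGroup E] [NormedSpace ℝ E] {v : E → ℝ}
    (hv : ContDiff ℝ 2 v) (x e : E) :
    iteratedDeriv 2 (fun a : ℝ => v (x + a • e)) 0
      = fderiv ℝ (fun z => fderiv ℝ v z e) x e := by
  have haff : ∀ a : ℝ, HasDerivAt (fun s : ℝ => x + s • e) e a := fun a => by
    simpa using ((hasDerivAt_id a).smul_const e).const_add x
  have hD : ContDiff ℝ 1 fun z => fderiv ℝ v z e :=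
    (hv.fderiv_right (m := 1) (by norm_num)).clm_apply contDiff_const
  have h1 : deriv (fun a : ℝ => v (x + a • e)) = fun a => fderiv ℝ v (x + a • e) e := by
    ext a
    exact ((hv.differentiable two_ne_zero _).hasFDerivAt.comp_hasDerivAt a (haff a)).deriv
  have h2 := ((hD.differentiable one_ne_zero (x + (0 : ℝ) • e)).hasFDerivAt.comp_hasDerivAt 0
    (haff 0)).deriv
  rw [iteratedDeriv_succ, iteratedDeriv_one, h1]
  simpa [Function.comp_def] using h2

lemma integrableOn_ball_abs_rpow {E : Type*} [MetricSpace E] [ProperSpace E]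
    [MeasurableSpace E] [OpensMeasurableSpace E] {μ : Measure E} [IsFiniteMeasureOnCompacts μ]
    {u : E → ℝ} {x₀ : E} {r p : ℝ} (hp : 0 ≤ p) (hu : ContinuousOn u (closedBall x₀ r)) :
    IntegrableOn (fun y => |u y| ^ p) (ball x₀ r) μ :=
  ((hu.abs.rpow_const fun _ _ => .inr hp).integrableOn_compact
    (isCompact_closedBall x₀ r)).mono_set ball_subset_closedBall

section

variable {E : Type*} [NormedAddCommGroup E] [InnerProductSpace ℝ E] [FiniteDimensional ℝ E]
  [MeasurableSpace E] [BorelSpace E]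

/-- Local version of `abs_mul_integral_radialWeight_le`. -/
lemma abs_mul_integral_radialWeight_le_of_contDiffOn {ι : Type*} [Fintype ι]
    (b : OrthonormalBasis ι ℝ E) {u : E → ℝ} {x₀ : E} {r : ℝ} (hu : ContDiffOn ℝ 2 u (ball x₀ r))
    (hΔ : ∀ y ∈ ball x₀ r, ∑ i, iteratedDeriv 2 (fun a : ℝ => u (y + a • b i)) 0 = 0)
    {x : E} {s : ℝ} (hs : 0 < s) (hx : dist x x₀ + s < r) :
    |u x| * ∫ y : E, radialWeight y ≤ (s ^ Module.finrank ℝ E)⁻¹ * ∫ y in ball x s, |u y| := by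
  obtain ⟨s', hss', hs'⟩ : ∃ s', s < s' ∧ dist x x₀ + s' < r := by
    obtain ⟨q, h1, h2⟩ := exists_between (lt_sub_iff_add_lt'.2 hx)
    exact ⟨q, h1, lt_sub_iff_add_lt'.1 h2⟩
  let χ : ContDiffBump x := ⟨s, s', hs, hss'⟩
  have hsub : closedBall x s' ⊆ ball x₀ r := closedBall_subset_ball' (by linarith)
  have hv : ContDiff ℝ 2 fun y => χ y * u y := by
    rw [contDiff_iff_contDiffAt]
    intro y
    by_cases hy : y ∈ ball x₀ r
    · exact χ.contDiffAt.mul (hu.contDiffAt (isOpen_ball.mem_nhds hy))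
    · have : (fun y => χ y * u y) =ᶠ[𝓝 y] fun _ => 0 := by
        filter_upwards [isClosed_closedBall.isOpen_compl.mem_nhds fun h => hy (hsub h)] with z hz
        have hz' : s' < dist z x := by simpa using hz
        rw [χ.zero_of_le_dist hz'.le, zero_mul]
      exact contDiffAt_const.congr_of_eventuallyEq this
  have heq : ∀ y ∈ ball x s, χ y * u y = u y := fun y hy => by
    rw [χ.one_of_mem_closedBall (ball_subset_closedBall hy), one_mul]
  have := abs_mul_integral_radialWeight_le b hv χ.hasCompactSupport.mul_right x hs fun y hy => by
    rw [← hΔ y (hsub ((ball_subset_ball hss'.le).trans ball_subset_closedBall hy))]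
    refine Finset.sum_congr rfl fun i _ => ?_
    rw [← iteratedDeriv_two_line hv]
    refine Filter.EventuallyEq.iteratedDeriv_eq 2 ?_
    have hc : ContinuousAt (fun a : ℝ => y + a • b i) 0 := by fun_prop
    filter_upwards [hc.preimage_mem_nhds (isOpen_ball.mem_nhds (by simpa using hy))] with a ha
    exact heq _ ha
  rwa [heq x (mem_ball_self hs),
    setIntegral_congr_fun measurableSet_ball fun y hy => congrArg abs (heq y hy)] at this

/-- A weak mean value inequality for `u` implies one for `|u| ^ p`, case `p ≤ 1`. -/
lemma abs_rpow_mul_pow_le_of_le_one {u : E → ℝ} {x₀ : E} {r W p : ℝ} {d : ℕ} (hd : d ≠ 0)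
    (hr : 0 < r) (hW : 0 < W) (hp : 0 < p) (hp1 : p ≤ 1) (hu : ContinuousOn u (closedBall x₀ r))
    (H : ∀ x s, 0 < s → dist x x₀ + s < r →
      |u x| * W ≤ (s ^ d)⁻¹ * ∫ y in ball x s, |u y|) :
    |u x₀| ^ p * r ^ d ≤
      2 ^ d * (((2 : ℝ) ^ d) ^ p⁻¹) ^ (1 - p) / W * ∫ y in ball x₀ r, |u y| ^ p := by
  have hint := integrableOn_ball_abs_rpow (μ := volume) hp.le hu
  have hA : 0 ≤ ∫ y in ball x₀ r, |u y| ^ p := integral_nonneg fun y => by positivity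
  obtain ⟨x, hx, hmax⟩ := (isCompact_closedBall x₀ r).exists_isMaxOn
    ⟨x₀, mem_closedBall_self hr.le⟩ (f := fun x => |u x| ^ p * (r - dist x x₀) ^ d)
    ((hu.abs.rpow_const fun _ _ => .inr hp.le).mul (by fun_prop))
  have h0 := hmax (mem_closedBall_self hr.le)
  simp only [mem_ofPred_eq, dist_self, sub_zero] at h0
  refine h0.trans ?_
  set δ := r - dist x x₀ with hδ
  have hδ0 : 0 ≤ δ := sub_nonneg.2 hx
  rcases hδ0.eq_or_lt with hδ' | hδ'
  · rw [← hδ', zero_pow hd, mul_zero]; positivity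
  rcases (abs_nonneg (u x)).eq_or_lt with hux | hux
  · rw [← hux, Real.zero_rpow hp.ne', zero_mul]; positivity
  have hsub : ball x (δ / 2) ⊆ ball x₀ r := ball_subset_ball' (by linarith)
  have hpt : ∀ y ∈ ball x (δ / 2),
      |u y| ≤ (((2 : ℝ) ^ d) ^ p⁻¹ * |u x|) ^ (1 - p) * |u y| ^ p := by
    intro y hy
    have hy' := hmax (ball_subset_closedBall (hsub hy))
    simp only [mem_ofPred_eq, ← hδ] at hy'
    have hdy : δ / 2 ≤ r - dist y x₀ := by
      have := dist_triangle y x x₀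
      have := mem_ball.1 hy
      linarith
    have h1 : |u y| ^ p * (δ / 2) ^ d ≤ |u x| ^ p * δ ^ d :=
      le_trans (by gcongr) hy'
    have h2 : |u y| ^ p ≤ 2 ^ d * |u x| ^ p := by
      rw [div_pow, ← mul_div_assoc, div_le_iff₀ (by positivity)] at h1
      refine le_of_mul_le_mul_right (h1.trans_eq ?_) (pow_pos hδ' d)
      ring
    have h3 : |u y| ≤ ((2 : ℝ) ^ d) ^ p⁻¹ * |u x| := by
      have := Real.rpow_le_rpow (by positivity) h2 (inv_nonneg.2 hp.le)
      rwa [Real.mul_rpow (by positivity) (by positivity), Real.rpow_rpow_inv (abs_nonneg _) hp.ne',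
        Real.rpow_rpow_inv (abs_nonneg _) hp.ne'] at this
    calc |u y| = |u y| ^ (1 - p) * |u y| ^ p := by
          rcases (abs_nonneg (u y)).eq_or_lt with h | h
          · rw [← h, Real.zero_rpow hp.ne', mul_zero]
          · rw [← Real.rpow_add h, sub_add_cancel, Real.rpow_one]
      _ ≤ _ := by
          gcongr
  have hH := H x (δ / 2) (by linarith) (by linarith)
  have hle : ∫ y in ball x (δ / 2), |u y| ≤
      (((2 : ℝ) ^ d) ^ p⁻¹ * |u x|) ^ (1 - p) * ∫ y in ball x₀ r, |u y| ^ p := by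
    rw [← integral_const_mul]
    refine (setIntegral_mono_on ?_ ((hint.mono_set hsub).const_mul _) measurableSet_ball hpt).trans
      (setIntegral_mono_set (hint.const_mul _)
        (.of_forall fun y => by simp only [Pi.zero_apply]; positivity) hsub.eventuallyLE)
    simpa using (integrableOn_ball_abs_rpow (μ := volume) zero_le_one hu).mono_set hsub
  have h4 : |u x| * W ≤ ((δ / 2) ^ d)⁻¹ * ((((2 : ℝ) ^ d) ^ p⁻¹ * |u x|) ^ (1 - p) *
      ∫ y in ball x₀ r, |u y| ^ p) := hH.trans (by gcongr)
  rw [Real.mul_rpow (by positivity) (by positivity)] at h4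
  set A := ∫ y in ball x₀ r, |u y| ^ p
  set K := (((2 : ℝ) ^ d) ^ p⁻¹) ^ (1 - p)
  have h5 : |u x| = |u x| ^ (1 - p) * |u x| ^ p := by
    rw [← Real.rpow_add hux, sub_add_cancel, Real.rpow_one]
  have h6 : |u x| ^ p * W ≤ ((δ / 2) ^ d)⁻¹ * (K * A) := by
    refine le_of_mul_le_mul_left ?_ (Real.rpow_pos_of_pos hux (1 - p))
    calc _ = |u x| * W := by rw [← mul_assoc, ← h5]
      _ ≤ _ := h4
      _ = _ := by ring
  rw [div_mul_eq_mul_div, le_div_iff₀ hW]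
  calc |u x| ^ p * δ ^ d * W = (|u x| ^ p * W) * δ ^ d := by ring
    _ ≤ (((δ / 2) ^ d)⁻¹ * (K * A)) * δ ^ d := by gcongr
    _ = 2 ^ d * K * A := by rw [div_pow]; field_simp

/-- A weak mean value inequality for `u` implies one for `|u| ^ p`, case `1 ≤ p`. -/
lemma abs_rpow_mul_pow_le_of_one_le {u : E → ℝ} {x₀ : E} {r W p : ℝ} {d : ℕ}
    (hd : Module.finrank ℝ E = d) (hr : 0 < r) (hW : 0 < W) (hp1 : 1 ≤ p)
    (hu : ContinuousOn u (closedBall x₀ r))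
    (H : ∀ x s, 0 < s → dist x x₀ + s < r →
      |u x| * W ≤ (s ^ d)⁻¹ * ∫ y in ball x s, |u y|) :
    |u x₀| ^ p * r ^ d ≤
      2 ^ d * (W / (2 * volume.real (ball (0 : E) 1))) ^ (1 - p) / (W / 2) *
        ∫ y in ball x₀ r, |u y| ^ p := by
  have hp : 0 < p := by linarith
  set ω := volume.real (ball (0 : E) 1)
  have hω : 0 < ω := ENNReal.toReal_pos (measure_ball_pos _ _ one_pos).ne' measure_ball_lt_top.ne
  have hint := integrableOn_ball_abs_rpow (μ := volume) hp.le hu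
  have hA : 0 ≤ ∫ y in ball x₀ r, |u y| ^ p := integral_nonneg fun y => by positivity
  rcases (abs_nonneg (u x₀)).eq_or_lt with hux | hux
  · rw [← hux, Real.zero_rpow hp.ne', zero_mul]; positivity
  have hsub : ball x₀ (r / 2) ⊆ ball x₀ r := ball_subset_ball (by linarith)
  set a := W / (2 * ω) * |u x₀| with ha
  have ha0 : 0 < a := by positivity
  have hpt : ∀ y ∈ ball x₀ (r / 2), |u y| ≤ a + a ^ (1 - p) * |u y| ^ p := by
    intro y _
    rcases le_total |u y| a with h | h
    · exact h.trans (le_add_of_nonneg_right (by positivity))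
    · have h0 : 0 < |u y| := ha0.trans_le h
      calc |u y| = |u y| ^ (1 - p) * |u y| ^ p := by
            rw [← Real.rpow_add h0, sub_add_cancel, Real.rpow_one]
        _ ≤ a ^ (1 - p) * |u y| ^ p :=
            mul_le_mul_of_nonneg_right (Real.rpow_le_rpow_of_nonpos ha0 h (by linarith))
              (by positivity)
        _ ≤ _ := le_add_of_nonneg_left ha0.le
  have hvol : volume.real (ball x₀ (r / 2)) = (r / 2) ^ d * ω := by
    rw [measureReal_def, Measure.addHaar_ball_of_pos _ _ (half_pos hr), ENNReal.toReal_mul,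
      hd, ENNReal.toReal_ofReal (by positivity)]
    rfl
  have hH := H x₀ (r / 2) (by linarith) (by rw [dist_self]; linarith)
  have hle : ∫ y in ball x₀ (r / 2), |u y| ≤
      (r / 2) ^ d * ω * a + a ^ (1 - p) * ∫ y in ball x₀ r, |u y| ^ p := by
    have hi : IntegrableOn (fun _ : E => a) (ball x₀ (r / 2)) :=
      integrableOn_const measure_ball_lt_top.ne
    have hi' := (hint.mono_set hsub).const_mul (a ^ (1 - p))
    refine (setIntegral_mono_on ?_ (hi.add hi') measurableSet_ball hpt).trans ?_
    · simpa using (integrableOn_ball_abs_rpow (μ := volume) zero_le_one hu).mono_set hsub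
    · rw [integral_add' hi hi', setIntegral_const, hvol, smul_eq_mul, integral_const_mul]
      gcongr
      exact .of_forall fun y => by simp only [Pi.zero_apply]; positivity
  set A := ∫ y in ball x₀ r, |u y| ^ p
  have h4 : |u x₀| * W ≤ ((r / 2) ^ d)⁻¹ * ((r / 2) ^ d * ω * a + a ^ (1 - p) * A) :=
    hH.trans (by gcongr)
  have h5 : ((r / 2) ^ d)⁻¹ * ((r / 2) ^ d * ω * a + a ^ (1 - p) * A)
      = |u x₀| * (W / 2) + ((r / 2) ^ d)⁻¹ * (a ^ (1 - p) * A) := by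
    rw [mul_add, ha]; field_simp
  have h6 : |u x₀| * (W / 2) ≤ ((r / 2) ^ d)⁻¹ * (a ^ (1 - p) * A) := by linarith
  rw [ha, Real.mul_rpow (by positivity) (by positivity)] at h6
  set K := (W / (2 * ω)) ^ (1 - p)
  have h7 : |u x₀| = |u x₀| ^ (1 - p) * |u x₀| ^ p := by
    rw [← Real.rpow_add hux, sub_add_cancel, Real.rpow_one]
  have h8 : |u x₀| ^ p * (W / 2) ≤ ((r / 2) ^ d)⁻¹ * (K * A) := by
    refine le_of_mul_le_mul_left ?_ (Real.rpow_pos_of_pos hux (1 - p))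
    calc _ = |u x₀| * (W / 2) := by rw [← mul_assoc, ← h7]
      _ ≤ _ := h6
      _ = _ := by ring
  rw [div_mul_eq_mul_div, le_div_iff₀ (by positivity)]
  calc |u x₀| ^ p * r ^ d * (W / 2) = (|u x₀| ^ p * (W / 2)) * r ^ d := by ring
    _ ≤ (((r / 2) ^ d)⁻¹ * (K * A)) * r ^ d := by gcongr
    _ = 2 ^ d * K * A := by rw [div_pow]; field_simp

end

/-- (Fefferman–Stein) Let `B` be a ball in ℝ^d, `u` harmonic in `B` (i.e. `u` is `C²` with
vanishing Laplacian on `B`) and continuous on its closure. Then for every `p > 0` there is a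
constant `C_p` (depending only on `p` and `d`) with
`|u(x₀)|^p ≤ C_p · (1/|B|) ∫_B |u(x)|^p dx`, where `x₀` is the center of `B`. -/
theorem statement11 (d : ℕ) (hd : 1 ≤ d) (p : ℝ) (hp : 0 < p) :
    ∃ C : ℝ, 0 < C ∧
      ∀ (x₀ : EuclideanSpace ℝ (Fin d)) (r : ℝ), 0 < r →
        ∀ u : EuclideanSpace ℝ (Fin d) → ℝ,
          ContDiffOn ℝ 2 u (Metric.ball x₀ r) →
          (∀ x ∈ Metric.ball x₀ r,
            (∑ i : Fin d,
              iteratedDeriv 2 (fun a : ℝ => u (x + a • EuclideanSpace.single i (1 : ℝ))) 0) = 0) →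
          ContinuousOn u (Metric.closedBall x₀ r) →
          |u x₀| ^ p ≤
            C * ((volume (Metric.ball x₀ r)).toReal)⁻¹ *
              ∫ x in Metric.ball x₀ r, |u x| ^ p := by
  have hW := integral_radialWeight_pos (E := EuclideanSpace ℝ (Fin d))
  have hfr : Module.finrank ℝ (EuclideanSpace ℝ (Fin d)) = d := finrank_euclideanSpace_fin
  set ω := volume.real (ball (0 : EuclideanSpace ℝ (Fin d)) 1)
  have hω : 0 < ω := ENNReal.toReal_pos (measure_ball_pos _ _ one_pos).ne' measure_ball_lt_top.ne
  obtain ⟨C, hC, h⟩ : ∃ C : ℝ, 0 < C ∧ ∀ (x₀ : EuclideanSpace ℝ (Fin d)) (r : ℝ), 0 < r →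
      ∀ u : EuclideanSpace ℝ (Fin d) → ℝ, ContinuousOn u (closedBall x₀ r) →
        (∀ x s, 0 < s → dist x x₀ + s < r → |u x| * (∫ y : EuclideanSpace ℝ (Fin d),
          radialWeight y) ≤ (s ^ d)⁻¹ * ∫ y in ball x s, |u y|) →
        |u x₀| ^ p * r ^ d ≤ C * ∫ y in ball x₀ r, |u y| ^ p := by
    rcases le_total p 1 with hp1 | hp1
    · exact ⟨_, by positivity, fun x₀ r hr u hu H =>
        abs_rpow_mul_pow_le_of_le_one (by lia) hr hW hp hp1 hu H⟩
    · exact ⟨_, by positivity, fun x₀ r hr u hu H =>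
        abs_rpow_mul_pow_le_of_one_le hfr hr hW hp1 hu H⟩
  refine ⟨C * ω, by positivity, fun x₀ r hr u hu hΔ huc => ?_⟩
  have key := h x₀ r hr u huc fun x s hs hx => by
    have := abs_mul_integral_radialWeight_le_of_contDiffOn (EuclideanSpace.basisFun (Fin d) ℝ) hu
      (by simpa only [EuclideanSpace.basisFun_apply] using hΔ) hs hx
    rwa [hfr] at this
  have hvol : (volume (ball x₀ r)).toReal = r ^ d * ω := by
    rw [Measure.addHaar_ball_of_pos _ _ hr, ENNReal.toReal_mul,
      ENNReal.toReal_ofReal (by positivity), hfr]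
    rfl
  have hrd : 0 < r ^ d := pow_pos hr d
  rw [hvol]
  calc |u x₀| ^ p ≤ (C * ∫ y in ball x₀ r, |u y| ^ p) / r ^ d := (le_div_iff₀ hrd).2 key
    _ = C * ω * (r ^ d * ω)⁻¹ * ∫ y in ball x₀ r, |u y| ^ p := by field_simp
end

section
/- (Journé's covering lemma) For every δ > 0 there is a constant c_δ, independent of Ω, such that for every open set Ω ⊂ R^n × R^m of finite measure: Σ_{R ∈ m_1(Ω)} |R| γ_2(R)^{−δ} ≤ c_δ |Ω| and Σ_{R ∈ m_2(Ω)} |R| γ_1(R)^{−δ} ≤ c_δ |Ω|. -/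
open MeasureTheory

noncomputable section

/-- The dyadic cube in ℝ^n of generation `k` indexed by `a ∈ ℤ^n`. -/
def dyadicCube (n : ℕ) (k : ℤ) (a : Fin n → ℤ) : Set (Fin n → ℝ) :=
  {x | ∀ i, (a i : ℝ) * (2 : ℝ) ^ k ≤ x i ∧ x i < ((a i : ℝ) + 1) * (2 : ℝ) ^ k}

/-- Parameters of a dyadic rectangle `R = I × J` in ℝ^n × ℝ^m. -/
abbrev RectParam (n m : ℕ) : Type := (ℤ × (Fin n → ℤ)) × (ℤ × (Fin m → ℤ))

/-- The dyadic rectangle `R = I × J` with the given parameters. -/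
def dyadicRect (n m : ℕ) (q : RectParam n m) : Set ((Fin n → ℝ) × (Fin m → ℝ)) :=
  dyadicCube n q.1.1 q.1.2 ×ˢ dyadicCube m q.2.1 q.2.2

/-- `Ω̃ = {x : M_s(χ_Ω)(x) > 1/2}`, where `M_s` is the strong maximal operator: the set of
points lying in some axis-parallel rectangle `R` (a product of cubes, i.e. of balls for the
sup norm) with `|R ∩ Ω| > |R|/2`. -/
def enlarge (n m : ℕ) (Ω : Set ((Fin n → ℝ) × (Fin m → ℝ))) :
    Set ((Fin n → ℝ) × (Fin m → ℝ)) :=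
  {p | ∃ (c₁ : Fin n → ℝ) (c₂ : Fin m → ℝ) (r₁ r₂ : ℝ), 0 < r₁ ∧ 0 < r₂ ∧
    p ∈ Metric.ball c₁ r₁ ×ˢ Metric.ball c₂ r₂ ∧
    volume (Metric.ball c₁ r₁ ×ˢ Metric.ball c₂ r₂) <
      2 * volume ((Metric.ball c₁ r₁ ×ˢ Metric.ball c₂ r₂) ∩ Ω)}

/-- `R = I × J ∈ m₁(Ω)`: `R` is a dyadic subrectangle of `Ω` that is maximal in the first
direction. -/
def MemM1 (n m : ℕ) (Ω : Set ((Fin n → ℝ) × (Fin m → ℝ))) (q : RectParam n m) : Prop :=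
  dyadicRect n m q ⊆ Ω ∧
    ∀ (k : ℤ) (a : Fin n → ℤ), dyadicCube n q.1.1 q.1.2 ⊆ dyadicCube n k a →
      dyadicCube n k a ×ˢ dyadicCube m q.2.1 q.2.2 ⊆ Ω →
      dyadicCube n k a = dyadicCube n q.1.1 q.1.2

/-- `R = I × J ∈ m₂(Ω)`: `R` is a dyadic subrectangle of `Ω` that is maximal in the second
direction. -/
def MemM2 (n m : ℕ) (Ω : Set ((Fin n → ℝ) × (Fin m → ℝ))) (q : RectParam n m) : Prop :=
  dyadicRect n m q ⊆ Ω ∧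
    ∀ (k : ℤ) (b : Fin m → ℤ), dyadicCube m q.2.1 q.2.2 ⊆ dyadicCube m k b →
      dyadicCube n q.1.1 q.1.2 ×ˢ dyadicCube m k b ⊆ Ω →
      dyadicCube m k b = dyadicCube m q.2.1 q.2.2

/-- For `R = I × J ∈ m₁(Ω)`: `γ₂(R) = sup {|l|/|J| : l` dyadic, `J ⊆ l`, `I × l ⊆ Ω̃}`,
the side-length ratio being `2^{k_l − k_J}`. -/
def gamma2 (n m : ℕ) (Ωt : Set ((Fin n → ℝ) × (Fin m → ℝ))) (q : RectParam n m) : ℝ :=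
  sSup {ρ : ℝ | ∃ (k : ℤ) (b : Fin m → ℤ),
    dyadicCube m q.2.1 q.2.2 ⊆ dyadicCube m k b ∧
    dyadicCube n q.1.1 q.1.2 ×ˢ dyadicCube m k b ⊆ Ωt ∧
    ρ = (2 : ℝ) ^ (k - q.2.1)}

/-- For `R = I × J ∈ m₂(Ω)`: `γ₁(R) = sup {|l|/|I| : l` dyadic, `I ⊆ l`, `l × J ⊆ Ω̃}`. -/
def gamma1 (n m : ℕ) (Ωt : Set ((Fin n → ℝ) × (Fin m → ℝ))) (q : RectParam n m) : ℝ :=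
  sSup {ρ : ℝ | ∃ (k : ℤ) (a : Fin n → ℤ),
    dyadicCube n q.1.1 q.1.2 ⊆ dyadicCube n k a ∧
    dyadicCube n k a ×ˢ dyadicCube m q.2.1 q.2.2 ⊆ Ωt ∧
    ρ = (2 : ℝ) ^ (k - q.1.1)}

section DyadicCubes

variable {n : ℕ} {k k' : ℤ} {a b : Fin n → ℤ} {x : Fin n → ℝ}

theorem index_eq_of_mem_dyadicCube (ha : x ∈ dyadicCube n k a) (hb : x ∈ dyadicCube n k b) :
    a = b := by
  funext i
  have hk : (0 : ℝ) < (2 : ℝ) ^ k := by positivity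
  have h1 : (a i : ℝ) < b i + 1 := lt_of_mul_lt_mul_right ((ha i).1.trans_lt (hb i).2) hk.le
  have h2 : (b i : ℝ) < a i + 1 := lt_of_mul_lt_mul_right ((hb i).1.trans_lt (ha i).2) hk.le
  norm_cast at h1 h2
  omega

/-- The index of the dyadic cube `j` generations above the one with index `a`. -/
def dyadicAncestor (j : ℕ) (a : Fin n → ℤ) : Fin n → ℤ := fun i => a i / 2 ^ j

theorem dyadicCube_subset_ancestor (j : ℕ) (k : ℤ) (a : Fin n → ℤ) :
    dyadicCube n k a ⊆ dyadicCube n (k + j) (dyadicAncestor j a) := by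
  intro x hx i
  have hk : (0 : ℝ) < (2 : ℝ) ^ k := by positivity
  have hj : (0 : ℤ) < 2 ^ j := by positivity
  have h1 : a i / 2 ^ j * 2 ^ j ≤ a i := Int.ediv_mul_le _ hj.ne'
  have h2 : a i + 1 ≤ (a i / 2 ^ j + 1) * 2 ^ j := Int.lt_ediv_add_one_mul_self _ hj
  have h1' : ((a i / 2 ^ j : ℤ) : ℝ) * 2 ^ j ≤ a i := by exact_mod_cast h1
  have h2' : (a i : ℝ) + 1 ≤ (((a i / 2 ^ j : ℤ) : ℝ) + 1) * 2 ^ j := by exact_mod_cast h2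
  have e : (2 : ℝ) ^ (k + j) = 2 ^ j * 2 ^ k := by
    rw [zpow_add₀ two_ne_zero, zpow_natCast, mul_comm]
  simp only [dyadicAncestor]
  rw [e, ← mul_assoc, ← mul_assoc]
  exact ⟨(mul_le_mul_of_nonneg_right h1' hk.le).trans (hx i).1,
    (hx i).2.trans_le (mul_le_mul_of_nonneg_right h2' hk.le)⟩

theorem dyadicCube_subset_of_mem (hk : k ≤ k') (ha : x ∈ dyadicCube n k a)
    (hb : x ∈ dyadicCube n k' b) : dyadicCube n k a ⊆ dyadicCube n k' b := by
  obtain ⟨j, rfl⟩ := Int.le.dest hk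
  have h := dyadicCube_subset_ancestor j k a
  rwa [index_eq_of_mem_dyadicCube (h ha) hb] at h

theorem le_of_dyadicCube_subset (hn : 1 ≤ n) (h : dyadicCube n k a ⊆ dyadicCube n k' b) :
    k ≤ k' := by
  by_contra! hlt
  have hk : (0 : ℝ) < (2 : ℝ) ^ k := by positivity
  have hk' : (0 : ℝ) < (2 : ℝ) ^ k' := by positivity
  have hkk : (2 : ℝ) ^ k' < 2 ^ k := zpow_lt_zpow_right₀ one_lt_two hlt
  have h1 : (fun i => (a i : ℝ) * 2 ^ k) ∈ dyadicCube n k a := fun i =>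
    ⟨le_rfl, by simp only; linarith⟩
  have h2 : (fun i => (a i : ℝ) * 2 ^ k + 2 ^ k') ∈ dyadicCube n k a := fun i =>
    ⟨by simp only; linarith, by simp only; linarith⟩
  have h3 := (h h1 ⟨0, hn⟩).1
  have h4 := (h h2 ⟨0, hn⟩).2
  linarith

theorem dyadicCube_eq_pi (n : ℕ) (k : ℤ) (a : Fin n → ℤ) : dyadicCube n k a =
    Set.univ.pi fun i => Set.Ico ((a i : ℝ) * 2 ^ k) (((a i : ℝ) + 1) * 2 ^ k) := by
  ext x
  simp [dyadicCube, Set.mem_pi]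

theorem measurableSet_dyadicCube (n : ℕ) (k : ℤ) (a : Fin n → ℤ) :
    MeasurableSet (dyadicCube n k a) := by
  rw [dyadicCube_eq_pi]
  exact MeasurableSet.univ_pi fun _ => measurableSet_Ico

theorem volume_dyadicCube (n : ℕ) (k : ℤ) (a : Fin n → ℤ) :
    volume (dyadicCube n k a) = ENNReal.ofReal (((2 : ℝ) ^ k) ^ n) := by
  rw [dyadicCube_eq_pi, volume_pi_pi, ENNReal.ofReal_pow (by positivity)]
  simp [add_mul]

theorem volume_dyadicCube_ne_zero (n : ℕ) (k : ℤ) (a : Fin n → ℤ) :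
    volume (dyadicCube n k a) ≠ 0 := by
  rw [volume_dyadicCube]
  exact (ENNReal.ofReal_pos.2 (by positivity)).ne'

theorem volume_dyadicCube_ne_top (n : ℕ) (k : ℤ) (a : Fin n → ℤ) :
    volume (dyadicCube n k a) ≠ ⊤ := by
  rw [volume_dyadicCube]
  exact ENNReal.ofReal_ne_top

theorem dyadicCube_subset_ball (n : ℕ) (k : ℤ) (a : Fin n → ℤ) {r : ℝ} (hr : 0 < r) :
    dyadicCube n k a ⊆ Metric.ball (fun i => ((a i : ℝ) + 1 / 2) * 2 ^ k) (2 ^ k / 2 + r) := by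
  intro x hx
  have hk : (0 : ℝ) < (2 : ℝ) ^ k := by positivity
  rw [Metric.mem_ball, dist_pi_lt_iff (by positivity)]
  intro i
  rw [Real.dist_eq, abs_lt]
  constructor <;> nlinarith [(hx i).1, (hx i).2]

end DyadicCubes

section Enlargement

variable {n m : ℕ} {Ω : Set ((Fin n → ℝ) × (Fin m → ℝ))}

theorem subset_enlarge (hΩ : IsOpen Ω) : Ω ⊆ enlarge n m Ω := by
  rintro ⟨x, y⟩ hp
  obtain ⟨r, hr, hsub⟩ := Metric.isOpen_iff.1 hΩ _ hp
  rw [← ball_prod_same] at hsub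
  refine ⟨x, y, r, r, hr, hr, ⟨Metric.mem_ball_self hr, Metric.mem_ball_self hr⟩, ?_⟩
  rw [Set.inter_eq_left.2 hsub, two_mul]
  refine ENNReal.lt_add_right ?_ ?_
  · rw [Measure.volume_eq_prod, Measure.prod_prod]
    exact ENNReal.mul_ne_top measure_ball_lt_top.ne measure_ball_lt_top.ne
  · exact ((Metric.isOpen_ball.prod Metric.isOpen_ball).measure_pos volume
      ⟨(x, y), Metric.mem_ball_self hr, Metric.mem_ball_self hr⟩).ne'

theorem dyadicRect_subset_enlarge {q : RectParam n m}
    (h : volume (dyadicRect n m q) < 2 * volume (dyadicRect n m q ∩ Ω)) :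
    dyadicRect n m q ⊆ enlarge n m Ω := by
  obtain ⟨⟨k, a⟩, ⟨l, b⟩⟩ := q
  let f : ℝ → ENNReal := fun ε =>
    ENNReal.ofReal ((2 * (2 ^ k / 2 + ε)) ^ n * (2 * (2 ^ l / 2 + ε)) ^ m)
  have hf : Continuous f := ENNReal.continuous_ofReal.comp (by fun_prop)
  have hf0 : f 0 = volume (dyadicRect n m ((k, a), (l, b))) := by
    simp only [f, dyadicRect]
    rw [Measure.volume_eq_prod, Measure.prod_prod, volume_dyadicCube, volume_dyadicCube,
      ← ENNReal.ofReal_mul (by positivity)]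
    congr 2 <;> ring
  obtain ⟨ε, hε, hε0⟩ := (((hf.tendsto 0).eventually_lt_const (hf0.trans_lt h)).filter_mono
    nhdsWithin_le_nhds |>.and (self_mem_nhdsWithin (s := Set.Ioi (0 : ℝ)))).exists
  have hε0 : 0 < ε := hε0
  have hsub : dyadicRect n m ((k, a), (l, b)) ⊆ _ :=
    Set.prod_mono (dyadicCube_subset_ball n k a hε0) (dyadicCube_subset_ball m l b hε0)
  intro p hp
  refine ⟨_, _, _, _, by positivity, by positivity, hsub hp, ?_⟩
  refine lt_of_eq_of_lt ?_
    (hε.trans_le (mul_le_mul_right (measure_mono (Set.inter_subset_inter_left _ hsub)) 2))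
  rw [Measure.volume_eq_prod, Measure.prod_prod, Real.volume_pi_ball _ (by positivity),
    Real.volume_pi_ball _ (by positivity), ← ENNReal.ofReal_mul (by positivity)]
  simp [f]

end Enlargement

section Shadow

variable {n m : ℕ} {Ω : Set ((Fin n → ℝ) × (Fin m → ℝ))}

/-- The union of the dyadic cubes `I` with `I × J ⊆ Ω`, where `J` is the dyadic cube of
generation `k` and index `b`. -/
def dyadicShadow (Ω : Set ((Fin n → ℝ) × (Fin m → ℝ))) (k : ℤ) (b : Fin m → ℤ) :
    Set (Fin n → ℝ) :=
  ⋃ (c : ℤ × (Fin n → ℤ)) (_ : dyadicCube n c.1 c.2 ×ˢ dyadicCube m k b ⊆ Ω),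
    dyadicCube n c.1 c.2

theorem measurableSet_dyadicShadow (k : ℤ) (b : Fin m → ℤ) :
    MeasurableSet (dyadicShadow Ω k b) :=
  MeasurableSet.iUnion fun _ => MeasurableSet.iUnion fun _ => measurableSet_dyadicCube _ _ _

theorem dyadicShadow_prod_subset (k : ℤ) (b : Fin m → ℤ) :
    dyadicShadow Ω k b ×ˢ dyadicCube m k b ⊆ Ω := by
  rintro ⟨x, y⟩ ⟨hx, hy⟩
  simp only [dyadicShadow, Set.mem_iUnion] at hx
  obtain ⟨c, hc, hx⟩ := hx
  exact hc ⟨hx, hy⟩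

theorem mem_dyadicShadow {q : RectParam n m} (hq : dyadicRect n m q ⊆ Ω) {k : ℤ} {b : Fin m → ℤ}
    (hb : dyadicCube m k b ⊆ dyadicCube m q.2.1 q.2.2) {x : Fin n → ℝ}
    (hx : x ∈ dyadicCube n q.1.1 q.1.2) : x ∈ dyadicShadow Ω k b := by
  simp only [dyadicShadow, Set.mem_iUnion]
  exact ⟨q.1, (Set.prod_mono_right hb).trans hq, hx⟩

/-- If `Ω` fills at most half of `I × J`, at least half of `I` lies off the shadow of `J`. -/
theorem volume_dyadicCube_le_two_mul_diff_shadow {q : RectParam n m}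
    (h : 2 * volume (dyadicRect n m q ∩ Ω) ≤ volume (dyadicRect n m q)) :
    volume (dyadicCube n q.1.1 q.1.2) ≤
      2 * volume (dyadicCube n q.1.1 q.1.2 \ dyadicShadow Ω q.2.1 q.2.2) := by
  set I := dyadicCube n q.1.1 q.1.2
  set J := dyadicCube m q.2.1 q.2.2 with hJ
  set E := dyadicShadow Ω q.2.1 q.2.2
  have hsub : (I ∩ E) ×ˢ J ⊆ dyadicRect n m q ∩ Ω := Set.subset_inter
    (Set.prod_mono_left Set.inter_subset_left)
    ((Set.prod_mono_left Set.inter_subset_right).trans (dyadicShadow_prod_subset _ _))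
  have h1 : 2 * volume (I ∩ E) * volume J ≤ volume I * volume J := by
    calc 2 * volume (I ∩ E) * volume J = 2 * volume ((I ∩ E) ×ˢ J) := by
          rw [Measure.volume_eq_prod, Measure.prod_prod, mul_assoc]
      _ ≤ _ := mul_le_mul_right (measure_mono hsub) 2
      _ ≤ _ := h
      _ = _ := by rw [dyadicRect, Measure.volume_eq_prod, Measure.prod_prod]
  have h2 : 2 * volume (I ∩ E) ≤ volume I :=
    (ENNReal.mul_le_mul_iff_left (volume_dyadicCube_ne_zero _ _ _)
      (volume_dyadicCube_ne_top _ _ _)).1 h1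
  have h3 : volume (I ∩ E) + volume (I \ E) = volume I :=
    measure_inter_add_sdiff I (measurableSet_dyadicShadow _ _)
  have hfin : volume (I ∩ E) ≠ ⊤ :=
    measure_ne_top_of_subset Set.inter_subset_left (volume_dyadicCube_ne_top _ _ _)
  have h4 : volume (I ∩ E) ≤ volume (I \ E) := by
    rw [← h3, two_mul] at h2
    exact (ENNReal.add_le_add_iff_left hfin).1 h2
  rw [← h3, two_mul]
  gcongr

end Shadow

section Counting

variable {n m : ℕ} {Ω : Set ((Fin n → ℝ) × (Fin m → ℝ))}

theorem MemM1.eq_of_mem (hn : 1 ≤ n) {q q' : RectParam n m} (hq : MemM1 n m Ω q)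
    (hq' : MemM1 n m Ω q') (hlev : q.2.1 = q'.2.1) {p : (Fin n → ℝ) × (Fin m → ℝ)}
    (hp : p ∈ dyadicRect n m q) (hp' : p ∈ dyadicRect n m q') : q = q' := by
  wlog hle : q.1.1 ≤ q'.1.1 generalizing q q'
  · exact (this hq' hq hlev.symm hp' hp (le_of_not_ge hle)).symm
  obtain ⟨⟨k, a⟩, ⟨l, b⟩⟩ := q
  obtain ⟨⟨k', a'⟩, ⟨l', b'⟩⟩ := q'
  obtain rfl : l = l' := hlev
  obtain rfl : b = b' := index_eq_of_mem_dyadicCube hp.2 hp'.2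
  have heq := hq.2 k' a' (dyadicCube_subset_of_mem hle hp.1 hp'.1) hq'.1
  obtain rfl : k = k' := le_antisymm hle (le_of_dyadicCube_subset hn heq.subset)
  obtain rfl : a = a' := index_eq_of_mem_dyadicCube hp.1 hp'.1
  rfl

/-- The parameters of `I × l`, where `l` is the `j`-th dyadic ancestor of `J`. -/
def RectParam.stretch (j : ℕ) (q : RectParam n m) : RectParam n m :=
  (q.1, (q.2.1 + j, dyadicAncestor j q.2.2))

/-- The part of `I × J` lying off the shadow of the `j`-th dyadic ancestor of `J`. -/
def offShadow (Ω : Set ((Fin n → ℝ) × (Fin m → ℝ))) (j : ℕ) (q : RectParam n m) :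
    Set ((Fin n → ℝ) × (Fin m → ℝ)) :=
  (dyadicCube n q.1.1 q.1.2 \ dyadicShadow Ω (q.stretch j).2.1 (q.stretch j).2.2) ×ˢ
    dyadicCube m q.2.1 q.2.2

theorem offShadow_subset (j : ℕ) (q : RectParam n m) :
    offShadow Ω j q ⊆ dyadicRect n m q :=
  Set.prod_mono_left Set.sdiff_subset

theorem measurableSet_offShadow (j : ℕ) (q : RectParam n m) :
    MeasurableSet (offShadow Ω j q) :=
  ((measurableSet_dyadicCube _ _ _).diff (measurableSet_dyadicShadow _ _)).prod
    (measurableSet_dyadicCube _ _ _)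

theorem level_lt_of_mem_offShadow {j : ℕ} {q q' : RectParam n m}
    (hq' : dyadicRect n m q' ⊆ Ω) {p : (Fin n → ℝ) × (Fin m → ℝ)}
    (hp : p ∈ offShadow Ω j q) (hp' : p ∈ offShadow Ω j q') : q'.2.1 < q.2.1 + j := by
  by_contra! hle
  exact hp.1.2 (mem_dyadicShadow hq'
    (dyadicCube_subset_of_mem hle (dyadicCube_subset_ancestor j _ _ hp.2) hp'.2) hp'.1.1)

theorem encard_offShadow_le (hn : 1 ≤ n) (j : ℕ) (p : (Fin n → ℝ) × (Fin m → ℝ)) :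
    {q : RectParam n m | MemM1 n m Ω q ∧ p ∈ offShadow Ω j q}.encard ≤ (2 * j : ℕ) := by
  set S := {q : RectParam n m | MemM1 n m Ω q ∧ p ∈ offShadow Ω j q}
  rcases S.eq_empty_or_nonempty with hS | ⟨q₀, hq₀⟩
  · simp [hS]
  have hinj : Set.InjOn (fun q : RectParam n m => q.2.1) S := fun q hq q' hq' h =>
    hq.1.eq_of_mem hn hq'.1 h (offShadow_subset _ _ hq.2) (offShadow_subset _ _ hq'.2)
  rw [← hinj.encard_image]
  have hsub : (fun q : RectParam n m => q.2.1) '' S ⊆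
      (Finset.Ioo (q₀.2.1 - j) (q₀.2.1 + j) : Set ℤ) := by
    rintro _ ⟨q, hq, rfl⟩
    have h1 := level_lt_of_mem_offShadow hq.1.1 hq₀.2 hq.2
    have h2 := level_lt_of_mem_offShadow hq₀.1.1 hq.2 hq₀.2
    simp only [Finset.coe_Ioo, Set.mem_Ioo]
    omega
  refine (Set.encard_le_encard hsub).trans ?_
  rw [Set.encard_coe_eq_coe_finsetCard, Int.card_Ioo]
  exact_mod_cast (by omega)

theorem tsum_volume_offShadow_le (hn : 1 ≤ n) (hΩ : MeasurableSet Ω) (j : ℕ) :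
    ∑' q : {q : RectParam n m // MemM1 n m Ω q}, volume (offShadow Ω j q.1) ≤
      (2 * j : ℕ) * volume Ω := by
  calc ∑' q : {q : RectParam n m // MemM1 n m Ω q}, volume (offShadow Ω j q.1)
      = ∫⁻ p, ∑' q : {q : RectParam n m // MemM1 n m Ω q},
          (offShadow Ω j q.1).indicator 1 p := by
        have hmeas : ∀ q : {q : RectParam n m // MemM1 n m Ω q}, AEMeasurable
            ((offShadow Ω j q.1).indicator (1 : (Fin n → ℝ) × (Fin m → ℝ) → ENNReal)) := fun q =>
          (measurable_one.indicator (measurableSet_offShadow j q.1)).aemeasurable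
        rw [lintegral_tsum hmeas]
        exact tsum_congr fun q => (lintegral_indicator_one (measurableSet_offShadow j q.1)).symm
    _ ≤ ∫⁻ p, Ω.indicator (fun _ => ((2 * j : ℕ) : ENNReal)) p := by
        refine lintegral_mono fun p => ?_
        by_cases hp : p ∈ Ω
        · rw [Set.indicator_of_mem hp]
          let T : Set {q : RectParam n m // MemM1 n m Ω q} := {q | p ∈ offShadow Ω j q.1}
          have hT : T.encard ≤ (2 * j : ℕ) := by
            rw [← Subtype.val_injective.encard_image]
            refine (Set.encard_le_encard ?_).trans (encard_offShadow_le (Ω := Ω) hn j p)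
            rintro _ ⟨q, hq, rfl⟩
            exact ⟨q.2, hq⟩
          calc ∑' q : {q : RectParam n m // MemM1 n m Ω q},
                (offShadow Ω j q.1).indicator (fun _ => (1 : ENNReal)) p
              = ∑' q, T.indicator (fun _ => (1 : ENNReal)) q := by
                refine tsum_congr fun q => ?_
                by_cases hq : p ∈ offShadow Ω j q.1
                · rw [Set.indicator_of_mem hq, Set.indicator_of_mem (show q ∈ T from hq)]
                · rw [Set.indicator_of_notMem hq, Set.indicator_of_notMem (show q ∉ T from hq)]
            _ = (T.encard : ENNReal) := by
                rw [← tsum_subtype]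
                exact ENNReal.tsum_set_one T
            _ ≤ (((2 * j : ℕ) : ℕ∞) : ENNReal) := ENat.toENNReal_le.2 hT
            _ = _ := ENat.toENNReal_coe _
        · rw [Set.indicator_of_notMem hp]
          refine le_of_eq (ENNReal.tsum_eq_zero.2 fun q => Set.indicator_of_notMem ?_ _)
          exact fun h => hp (q.2.1 (offShadow_subset _ _ h))
    _ = _ := by rw [lintegral_indicator_const hΩ]

end Counting

section Journe

variable {n m : ℕ} {Ω : Set ((Fin n → ℝ) × (Fin m → ℝ))}

/-- Rectangles of zero `gamma2` (the junk value of an unbounded supremum) aside, `I × J` fails to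
fit into `Ω̃` for the first time when stretched over the `(j + 1)`-st ancestor of `J`. -/
theorem exists_stretch_le_gamma2 (hΩ : IsOpen Ω) {q : RectParam n m}
    (hq : dyadicRect n m q ⊆ Ω) (hγ : gamma2 n m (enlarge n m Ω) q ≠ 0) :
    ∃ j : ℕ, (2 : ℝ) ^ j ≤ gamma2 n m (enlarge n m Ω) q ∧
      2 * volume (dyadicRect n m (q.stretch (j + 1)) ∩ Ω) ≤
        volume (dyadicRect n m (q.stretch (j + 1))) := by
  have hbdd : BddAbove {ρ : ℝ | ∃ (k : ℤ) (b : Fin m → ℤ),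
      dyadicCube m q.2.1 q.2.2 ⊆ dyadicCube m k b ∧
      dyadicCube n q.1.1 q.1.2 ×ˢ dyadicCube m k b ⊆ enlarge n m Ω ∧
      ρ = (2 : ℝ) ^ (k - q.2.1)} := by
    by_contra h
    exact hγ (Real.sSup_of_not_bddAbove h)
  have hle : ∀ j : ℕ, dyadicRect n m (q.stretch j) ⊆ enlarge n m Ω →
      (2 : ℝ) ^ j ≤ gamma2 n m (enlarge n m Ω) q := fun j hj =>
    le_csSup hbdd ⟨_, _, dyadicCube_subset_ancestor j _ _, hj, by simp⟩
  have hex : ∃ j : ℕ, ¬ dyadicRect n m (q.stretch (j + 1)) ⊆ enlarge n m Ω := by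
    by_contra! h
    obtain ⟨j, hj⟩ := pow_unbounded_of_one_lt (gamma2 n m (enlarge n m Ω) q) one_lt_two
    exact absurd (hle _ (h j)) (not_le.2 (hj.trans (pow_lt_pow_right₀ one_lt_two j.lt_succ_self)))
  classical
  refine ⟨Nat.find hex, hle _ ?_, ?_⟩
  · rcases h0 : Nat.find hex with _ | i
    · have : q.stretch 0 = q := by
        have h1 : dyadicAncestor 0 q.2.2 = q.2.2 := by
          funext i
          simp [dyadicAncestor]
        simp [RectParam.stretch, h1]
      rw [this]
      exact hq.trans (subset_enlarge hΩ)
    · exact not_not.1 (Nat.find_min hex (h0 ▸ i.lt_succ_self))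
  · exact not_lt.1 (mt dyadicRect_subset_enlarge (Nat.find_spec hex))

theorem volume_dyadicRect_le_two_mul_offShadow {j : ℕ} {q : RectParam n m}
    (h : 2 * volume (dyadicRect n m (q.stretch j) ∩ Ω) ≤ volume (dyadicRect n m (q.stretch j))) :
    volume (dyadicRect n m q) ≤ 2 * volume (offShadow Ω j q) := by
  rw [dyadicRect, offShadow, Measure.volume_eq_prod, Measure.prod_prod, Measure.prod_prod,
    ← mul_assoc]
  exact mul_le_mul_left (volume_dyadicCube_le_two_mul_diff_shadow h) _

theorem tsum_memM1_le (hn : 1 ≤ n) {δ : ℝ} (hδ : 0 < δ) (hΩ : IsOpen Ω) :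
    ∑' q : {q : RectParam n m // MemM1 n m Ω q},
        volume (dyadicRect n m q.1) *
          ENNReal.ofReal (gamma2 n m (enlarge n m Ω) q.1 ^ (-δ)) ≤
      (∑' j : ℕ, ENNReal.ofReal (4 * (j + 1) * ((2 : ℝ) ^ (-δ)) ^ j)) * volume Ω := by
  set w : ℝ := (2 : ℝ) ^ (-δ)
  have hw : 0 ≤ w := by positivity
  calc ∑' q : {q : RectParam n m // MemM1 n m Ω q},
        volume (dyadicRect n m q.1) *
          ENNReal.ofReal (gamma2 n m (enlarge n m Ω) q.1 ^ (-δ))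
      ≤ ∑' (q : {q : RectParam n m // MemM1 n m Ω q}) (j : ℕ),
          2 * ENNReal.ofReal (w ^ j) * volume (offShadow Ω (j + 1) q.1) := by
        refine ENNReal.tsum_le_tsum fun q => ?_
        by_cases hγ : gamma2 n m (enlarge n m Ω) q.1 = 0
        · simp [hγ, Real.zero_rpow (neg_ne_zero.2 hδ.ne')]
        obtain ⟨j, hj, hvol⟩ := exists_stretch_le_gamma2 hΩ q.2.1 hγ
        refine le_trans ?_ (ENNReal.le_tsum j)
        have hpow : gamma2 n m (enlarge n m Ω) q.1 ^ (-δ) ≤ w ^ j := by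
          calc _ ≤ ((2 : ℝ) ^ j) ^ (-δ) :=
                Real.rpow_le_rpow_of_nonpos (by positivity) hj (by linarith)
            _ = w ^ j := by
                rw [← Real.rpow_natCast, ← Real.rpow_natCast, ← Real.rpow_mul two_pos.le,
                  ← Real.rpow_mul two_pos.le, mul_comm]
        calc _ ≤ 2 * volume (offShadow Ω (j + 1) q.1) * ENNReal.ofReal (w ^ j) :=
              mul_le_mul' (volume_dyadicRect_le_two_mul_offShadow hvol)
                (ENNReal.ofReal_le_ofReal hpow)
          _ = _ := by ring
    _ = ∑' j : ℕ, 2 * ENNReal.ofReal (w ^ j) *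
          ∑' q : {q : RectParam n m // MemM1 n m Ω q}, volume (offShadow Ω (j + 1) q.1) := by
        rw [ENNReal.tsum_comm]
        simp only [ENNReal.tsum_mul_left]
    _ ≤ ∑' j : ℕ, ENNReal.ofReal (4 * (j + 1) * w ^ j) * volume Ω := by
        refine ENNReal.tsum_le_tsum fun j => ?_
        refine (mul_le_mul_right (tsum_volume_offShadow_le hn hΩ.measurableSet (j + 1)) _).trans
          (le_of_eq ?_)
        have e : (4 * ((j : ℝ) + 1) * w ^ j) = 2 * w ^ j * ((2 * (j + 1) : ℕ) : ℝ) := by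
          push_cast
          ring
        rw [e, ENNReal.ofReal_mul (by positivity), ENNReal.ofReal_mul two_pos.le,
          ENNReal.ofReal_natCast, ENNReal.ofReal_ofNat, ← mul_assoc]
    _ = _ := ENNReal.tsum_mul_right

end Journe

section Swap

variable {n m : ℕ}

theorem volume_preimage_swap (s : Set ((Fin n → ℝ) × (Fin m → ℝ))) :
    volume (Prod.swap ⁻¹' s) = volume s :=
  (Measure.measurePreserving_swap (μ := (volume : Measure (Fin m → ℝ)))
    (ν := (volume : Measure (Fin n → ℝ)))).measure_preimage_equiv (f := MeasurableEquiv.prodComm) s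

theorem prod_subset_preimage_swap {α β : Type*} {s : Set α} {t : Set β} {u : Set (β × α)} :
    s ×ˢ t ⊆ Prod.swap ⁻¹' u ↔ t ×ˢ s ⊆ u := by
  rw [← Set.image_subset_iff, Set.image_swap_prod]

theorem enlarge_preimage_swap (Ω : Set ((Fin n → ℝ) × (Fin m → ℝ))) :
    enlarge m n (Prod.swap ⁻¹' Ω) = Prod.swap ⁻¹' enlarge n m Ω := by
  have hvol : ∀ (s : Set (Fin n → ℝ)) (t : Set (Fin m → ℝ)),
      volume (t ×ˢ s) = volume (s ×ˢ t) ∧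
        volume (t ×ˢ s ∩ Prod.swap ⁻¹' Ω) = volume (s ×ˢ t ∩ Ω) := fun s t => by
    rw [← volume_preimage_swap (s ×ˢ t), ← volume_preimage_swap (s ×ˢ t ∩ Ω),
      Set.preimage_inter, Set.preimage_swap_prod]
    exact ⟨rfl, rfl⟩
  ext ⟨y, x⟩
  constructor
  · rintro ⟨c₁, c₂, r₁, r₂, h₁, h₂, hp, hlt⟩
    refine ⟨c₂, c₁, r₂, r₁, h₂, h₁, hp.symm, ?_⟩
    rwa [(hvol _ _).1, (hvol _ _).2] at hlt
  · rintro ⟨c₁, c₂, r₁, r₂, h₁, h₂, hp, hlt⟩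
    refine ⟨c₂, c₁, r₂, r₁, h₂, h₁, hp.symm, ?_⟩
    rwa [(hvol _ _).1, (hvol _ _).2]

theorem memM1_preimage_swap {Ω : Set ((Fin n → ℝ) × (Fin m → ℝ))} (q : RectParam n m) :
    MemM1 m n (Prod.swap ⁻¹' Ω) q.swap ↔ MemM2 n m Ω q := by
  simp only [MemM1, MemM2, dyadicRect, prod_subset_preimage_swap, Prod.fst_swap, Prod.snd_swap]

theorem gamma2_preimage_swap (s : Set ((Fin n → ℝ) × (Fin m → ℝ))) (q : RectParam n m) :
    gamma2 m n (Prod.swap ⁻¹' s) q.swap = gamma1 n m s q := by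
  simp only [gamma1, gamma2, prod_subset_preimage_swap, Prod.fst_swap, Prod.snd_swap]

theorem volume_dyadicRect_swap (q : RectParam n m) :
    volume (dyadicRect m n q.swap) = volume (dyadicRect n m q) := by
  rw [← volume_preimage_swap (dyadicRect n m q), dyadicRect, dyadicRect, Set.preimage_swap_prod]
  rfl

theorem tsum_memM2_eq (Ω : Set ((Fin n → ℝ) × (Fin m → ℝ))) (δ : ℝ) :
    ∑' q : {q : RectParam n m // MemM2 n m Ω q},
        volume (dyadicRect n m q.1) *
          ENNReal.ofReal (gamma1 n m (enlarge n m Ω) q.1 ^ (-δ)) =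
      ∑' q : {q : RectParam m n // MemM1 m n (Prod.swap ⁻¹' Ω) q},
        volume (dyadicRect m n q.1) *
          ENNReal.ofReal (gamma2 m n (enlarge m n (Prod.swap ⁻¹' Ω)) q.1 ^ (-δ)) := by
  rw [← ((Equiv.prodComm _ _).subtypeEquiv fun q => (memM1_preimage_swap q).symm).tsum_eq]
  refine tsum_congr fun q => ?_
  rw [enlarge_preimage_swap, ← gamma2_preimage_swap, ← volume_dyadicRect_swap q.1]
  rfl

end Swap

/-- Journé's covering lemma: for every `δ > 0` there is `c_δ`, independent of `Ω`, such that
for every open `Ω ⊆ ℝ^n × ℝ^m` of finite measure,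
`Σ_{R ∈ m₁(Ω)} |R| γ₂(R)^{−δ} ≤ c_δ |Ω|` and `Σ_{R ∈ m₂(Ω)} |R| γ₁(R)^{−δ} ≤ c_δ |Ω|`. -/
theorem statement17 (n m : ℕ) (hn : 1 ≤ n) (hm : 1 ≤ m) (δ : ℝ) (hδ : 0 < δ) :
    ∃ c : ℝ, 0 < c ∧
      ∀ Ω : Set ((Fin n → ℝ) × (Fin m → ℝ)), IsOpen Ω → volume Ω < ⊤ →
        (∑' q : {q : RectParam n m // MemM1 n m Ω q},
            volume (dyadicRect n m q.1) *
              ENNReal.ofReal (gamma2 n m (enlarge n m Ω) q.1 ^ (-δ))) ≤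
          ENNReal.ofReal c * volume Ω ∧
        (∑' q : {q : RectParam n m // MemM2 n m Ω q},
            volume (dyadicRect n m q.1) *
              ENNReal.ofReal (gamma1 n m (enlarge n m Ω) q.1 ^ (-δ))) ≤
          ENNReal.ofReal c * volume Ω := by
  have hw : (2 : ℝ) ^ (-δ) < 1 := Real.rpow_lt_one_of_one_lt_of_neg one_lt_two (by linarith)
  have hw0 : (0 : ℝ) < 2 ^ (-δ) := by positivity
  have hsum : Summable fun j : ℕ => 4 * ((j : ℝ) + 1) * ((2 : ℝ) ^ (-δ)) ^ j := by
    have hnorm : ‖(2 : ℝ) ^ (-δ)‖ < 1 := by rwa [Real.norm_of_nonneg hw0.le]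
    have h1 := summable_pow_mul_geometric_of_norm_lt_one 1 hnorm
    have h2 := summable_geometric_of_norm_lt_one hnorm
    refine ((h1.add h2).mul_left 4).congr fun j => ?_
    ring
  have hnonneg : ∀ j : ℕ, 0 ≤ 4 * ((j : ℝ) + 1) * ((2 : ℝ) ^ (-δ)) ^ j := fun j => by positivity
  refine ⟨∑' j : ℕ, 4 * ((j : ℝ) + 1) * ((2 : ℝ) ^ (-δ)) ^ j,
    hsum.tsum_pos hnonneg 0 (by norm_num), fun Ω hΩ _ => ?_⟩
  rw [ENNReal.ofReal_tsum_of_nonneg hnonneg hsum]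
  refine ⟨tsum_memM1_le hn hδ hΩ, ?_⟩
  rw [tsum_memM2_eq, ← volume_preimage_swap Ω]
  exact tsum_memM1_le hm hδ (hΩ.preimage continuous_swap)
end
end
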